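/- arXiv:math/0210088 — 4 statements merged into one kernel-verified Lean document; each statement's English description precedes it below -/
import Mathlib

section
/- Let Ω be a locally compact Hausdorff topological space and let E = C₀(Ω, ℝ) be the Banach lattice of real continuous functions on Ω vanishing at infinity, with the supremum norm and pointwise order. A net (x_α) in E d-converges to 0 if and only if (x_α) converges to 0 uniformly on every compact subset of Ω. -/
open Filter Topology ZeroAtInfty

/-- In the Banach lattice `E = C₀(Ω, ℝ)` of real continuous functions vanishing at
infinity on a locally compact Hausdorff space `Ω` (sup norm, pointwise order), a net
`(x_α)` d-converges to `0` — i.e. `‖|x_α| ⊓ y‖ = ⨆ t, min |x_α t| (y t)` tends to `0` for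
every `0 ≤ y ∈ E` — if and only if `(x_α)` converges to `0` uniformly on every compact
subset of `Ω`. -/
theorem stmt11 {Ω : Type*} [TopologicalSpace Ω] [LocallyCompactSpace Ω] [T2Space Ω]
    {ι : Type*} (l : Filter ι) (x : ι → C₀(Ω, ℝ)) :
    (∀ y : C₀(Ω, ℝ), (∀ t : Ω, 0 ≤ y t) →
        Tendsto (fun α => ⨆ t : Ω, min |x α t| (y t)) l (𝓝 0)) ↔
      (∀ K : Set Ω, IsCompact K →
        TendstoUniformlyOn (fun α t => x α t) 0 l K) := by
  constructor
  · intro h K hK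
    obtain ⟨f, hfK, -, hfc, hf01⟩ := exists_continuous_one_zero_of_isCompact hK isClosed_empty
      (Set.disjoint_empty K)
    let y : C₀(Ω, ℝ) := ⟨f, hfc.is_zero_at_infty⟩
    rw [Metric.tendstoUniformlyOn_iff]
    intro ε hε
    filter_upwards [(h y fun t => (hf01 t).1).eventually_lt_const (lt_min hε one_pos)]
      with α hα t ht
    have hbdd : BddAbove (Set.range fun t => min |x α t| (y t)) := by
      refine ⟨1, ?_⟩
      rintro _ ⟨s, rfl⟩
      exact (min_le_right _ _).trans (hf01 s).2
    have hlt := (le_ciSup hbdd t).trans_lt hα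
    have hyt : y t = 1 := hfK ht
    simp only [hyt, lt_min_iff] at hlt
    have hx : |x α t| < ε := by
      rcases min_lt_iff.1 hlt.2 with h1 | h1
      · simpa [min_eq_left h1.le] using hlt.1
      · exact absurd h1 (lt_irrefl _)
    simpa [Real.dist_eq] using hx
  · intro h y hy
    have hnonneg : ∀ α, 0 ≤ ⨆ t : Ω, min |x α t| (y t) := fun α =>
      Real.iSup_nonneg fun t => le_min (abs_nonneg _) (hy t)
    rw [Metric.tendsto_nhds]
    intro ε hε
    have hev : ∀ᶠ t in cocompact Ω, y t < ε / 2 :=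
      (zero_at_infty y).eventually_lt_const (half_pos hε)
    obtain ⟨K, hK, hKy⟩ := mem_cocompact.1 hev
    filter_upwards [Metric.tendstoUniformlyOn_iff.1 (h K hK) (ε / 2) (half_pos hε)] with α hα
    rw [Real.dist_eq, sub_zero, abs_of_nonneg (hnonneg α)]
    refine (Real.iSup_le (fun t => ?_) (half_pos hε).le).trans_lt (half_lt_self hε)
    by_cases ht : t ∈ K
    · have hx : |x α t| < ε / 2 := by simpa [Real.dist_eq] using hα t ht
      exact (min_le_left _ _).trans hx.le
    · exact (min_le_right _ _).trans (le_of_lt (hKy ht))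
end

section
/- In the Banach lattice c₀ of real sequences converging to 0 (with supremum norm and coordinatewise order), a net (x_α) d-converges to 0 if and only if it converges to 0 coordinatewise, i.e. x_α(k) → 0 for every k ∈ ℕ. -/
open Filter Topology ZeroAtInfty

/-- The strictly positive null sequence `k ↦ 1 / (k + 1)`. -/
noncomputable def invSuccSeq : C₀(ℕ, ℝ) where
  toFun k := 1 / ((k : ℝ) + 1)
  continuous_toFun := continuous_of_discreteTopology
  zero_at_infty' := by
    rw [cocompact_eq_cofinite, Nat.cofinite_eq_atTop]
    exact tendsto_one_div_add_atTop_nhds_zero_nat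

lemma invSuccSeq_pos (k : ℕ) : 0 < invSuccSeq k :=
  Nat.one_div_pos_of_nat

lemma ZeroAtInftyContinuousMap.bddAbove_range_min_abs (x y : C₀(ℕ, ℝ)) :
    BddAbove (Set.range fun k : ℕ => min |x k| (y k)) := by
  refine ⟨‖x.toBCF‖, ?_⟩
  rintro _ ⟨k, rfl⟩
  exact (min_le_left _ _).trans (x.toBCF.norm_coe_le_norm k)

/-- In the Banach lattice `c₀ = C₀(ℕ, ℝ)` of real null sequences (sup norm, coordinatewise
order), a net `(x_α)` d-converges to `0` — i.e. `‖|x_α| ⊓ y‖ = ⨆ k, min |x_α k| (y k)`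
tends to `0` for every `0 ≤ y ∈ c₀` — if and only if it converges to `0` coordinatewise. -/
theorem stmt12 {ι : Type*} (l : Filter ι) (x : ι → C₀(ℕ, ℝ)) :
    (∀ y : C₀(ℕ, ℝ), (∀ k : ℕ, 0 ≤ y k) →
        Tendsto (fun α => ⨆ k : ℕ, min |x α k| (y k)) l (𝓝 0)) ↔
      (∀ k : ℕ, Tendsto (fun α => x α k) l (𝓝 0)) := by
  constructor
  · intro h k
    have hsup := h invSuccSeq fun k => (invSuccSeq_pos k).le
    have hle (α : ι) : min |x α k| (invSuccSeq k) ≤ ⨆ k : ℕ, min |x α k| (invSuccSeq k) :=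
      le_ciSup (ZeroAtInftyContinuousMap.bddAbove_range_min_abs (x α) invSuccSeq) k
    rw [tendsto_zero_iff_abs_tendsto_zero]
    refine squeeze_zero' (.of_forall fun α => abs_nonneg _) ?_ hsup
    filter_upwards [hsup.eventually_lt_const (invSuccSeq_pos k)] with α hα
    exact (min_le_iff.1 (hle α)).resolve_right hα.not_ge
  · intro h y hy
    have hy0 : Tendsto y atTop (𝓝 0) := by
      have := y.zero_at_infty'
      rwa [cocompact_eq_cofinite, Nat.cofinite_eq_atTop] at this
    rw [Metric.tendsto_nhds]
    intro ε hε
    obtain ⟨N, hN⟩ := eventually_atTop.1 (hy0.eventually_lt_const (half_pos hε))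
    have hx : ∀ᶠ α in l, ∀ k ∈ Finset.range N, |x α k| < ε / 2 := by
      rw [eventually_all_finset]
      intro k _
      simpa using Metric.tendsto_nhds.1 (h k) (ε / 2) (half_pos hε)
    filter_upwards [hx] with α hα
    have hnonneg : 0 ≤ ⨆ k : ℕ, min |x α k| (y k) :=
      Real.iSup_nonneg fun k => le_min (abs_nonneg _) (hy k)
    rw [Real.dist_0_eq_abs, abs_of_nonneg hnonneg]
    refine (ciSup_le fun k => ?_).trans_lt (half_lt_self hε)
    rcases lt_or_ge k N with hk | hk
    · exact (min_le_left _ _).trans (hα k (Finset.mem_range.2 hk)).le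
    · exact (min_le_right _ _).trans (hN k hk).le
end

section
/- Let μ be a finite measure and 1 ≤ p < ∞. A net (x_α) in the real Banach lattice L_p(μ) d-converges to 0 if and only if it converges to 0 in measure, i.e. μ({|x_α| > ε}) → 0 for every ε > 0. -/
open Filter Topology MeasureTheory ENNReal

/-- If `|x|` exceeds `ε ≥ 0` only on a set where the restriction of `y` has `L_p` norm at most `δ`,
then `|x| ⊓ y` has `L_p` norm at most `δ` plus that of the constant function `ε`. -/
lemma eLpNorm_abs_inf_le {α : Type*} [MeasurableSpace α] {μ : Measure α} {p : ℝ≥0∞}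
    (hp : 1 ≤ p) {x y : Lp ℝ p μ} (hy : 0 ≤ y) {ε : ℝ} (hε : 0 ≤ ε)
    {δ : ℝ≥0∞} (h : eLpNorm ({t | ε < |x t|}.indicator y) p μ ≤ δ) :
    eLpNorm (|x| ⊓ y : Lp ℝ p μ) p μ ≤ eLpNorm (fun _ : α => ε) p μ + δ := by
  have hs : MeasurableSet {t | ε < |x t|} :=
    measurableSet_lt measurable_const (Lp.stronglyMeasurable x).measurable.abs
  calc eLpNorm (|x| ⊓ y : Lp ℝ p μ) p μ
      ≤ eLpNorm ((fun _ : α => ε) + {t | ε < |x t|}.indicator y) p μ := by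
        refine eLpNorm_mono_ae ?_
        filter_upwards [Lp.coeFn_inf |x| y, Lp.coeFn_abs x, (Lp.coeFn_nonneg y).mpr hy]
          with t h₁ h₂ h₃
        simp only [Pi.zero_apply] at h₃
        rw [h₁, Pi.inf_apply, h₂, Real.norm_of_nonneg (le_inf (abs_nonneg _) h₃)]
        by_cases ht : ε < |x t|
        · simpa [ht, Real.norm_eq_abs] using
            Or.inr ((le_add_of_nonneg_left hε).trans (le_abs_self (ε + y t)))
        · simpa [ht] using Or.inl ((not_lt.mp ht).trans (le_abs_self ε))
    _ ≤ eLpNorm (fun _ : α => ε) p μ + eLpNorm ({t | ε < |x t|}.indicator y) p μ :=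
        eLpNorm_add_le aestronglyMeasurable_const
          ((Lp.aestronglyMeasurable y).indicator hs) hp
    _ ≤ _ := by gcongr

/-- For a finite measure `μ` and `1 ≤ p < ∞`, a net `(x_α)` in the real Banach lattice
`L_p(μ)` d-converges to `0` if and only if it converges to `0` in measure. -/
theorem stmt13 {α : Type*} [MeasurableSpace α] (μ : Measure α) [IsFiniteMeasure μ]
    (p : ℝ≥0∞) [Fact (1 ≤ p)] (hp : p ≠ ∞)
    {ι : Type*} (l : Filter ι) (x : ι → Lp ℝ p μ) :
    (∀ y : Lp ℝ p μ, 0 ≤ y → Tendsto (fun i => ‖|x i| ⊓ y‖) l (𝓝 0)) ↔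
      (∀ ε : ℝ, 0 < ε → Tendsto (fun i => μ {t | ε < |(x i : α → ℝ) t|}) l (𝓝 0)) := by
  have hp1 : 1 ≤ p := Fact.out
  constructor
  · intro h ε hε
    obtain ⟨y, hc⟩ : ∃ y : Lp ℝ p μ, y =ᵐ[μ] fun _ => ε :=
      ⟨(memLp_const ε).toLp _, MemLp.coeFn_toLp _⟩
    have hy : 0 ≤ y := by
      rw [← Lp.coeFn_nonneg]
      filter_upwards [hc] with t ht
      simpa [ht] using hε.le
    have hlim : Tendsto (fun i => |x i| ⊓ y) l (𝓝 0) :=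
      tendsto_zero_iff_norm_tendsto_zero.mpr (h y hy)
    have hmeas : TendstoInMeasure μ (fun i => ((|x i| ⊓ y : Lp ℝ p μ) : α → ℝ)) l
        (0 : Lp ℝ p μ) := tendstoInMeasure_of_tendsto_Lp hlim
    have hm := tendstoInMeasure_iff_norm.mp hmeas ε hε
    refine tendsto_of_tendsto_of_tendsto_of_le_of_le tendsto_const_nhds hm
      (fun _ => zero_le) fun i => measure_mono_ae ?_
    filter_upwards [Lp.coeFn_inf |x i| y, Lp.coeFn_abs (x i), hc,
      Lp.coeFn_zero ℝ p μ] with t h₁ h₂ h₃ h₄ (ht : ε < |x i t|)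
    change ε ≤ ‖_ - _‖
    rw [h₁, h₄, Pi.inf_apply, h₂, h₃]
    simp [inf_eq_right.mpr ht.le, le_abs_self]
  · intro h y hy
    simp_rw [Lp.norm_def]
    rw [← ENNReal.toReal_zero]
    refine (ENNReal.tendsto_toReal zero_ne_top).comp (ENNReal.tendsto_nhds_zero.mpr fun δ hδ => ?_)
    have hδ2 : 0 < δ / 2 := ENNReal.half_pos hδ.ne'
    obtain ⟨r, hr, hrδ⟩ : ∃ r : ℝ, 0 < r ∧ ENNReal.ofReal r ≤ δ / 2 := by
      obtain ⟨r, hr, hrδ⟩ := ENNReal.lt_iff_exists_nnreal_btwn.mp hδ2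
      exact ⟨r, by exact_mod_cast hr, by simpa using hrδ.le⟩
    obtain ⟨ε, hε, hεδ⟩ : ∃ ε : ℝ, 0 < ε ∧ eLpNorm (fun _ : α => ε) p μ ≤ δ / 2 := by
      have hp0 : p ≠ 0 := (zero_lt_one.trans_le hp1).ne'
      have hlim : Tendsto (fun ε : ℝ => eLpNorm (fun _ : α => ε) p μ) (𝓝[>] 0) (𝓝 0) := by
        simp_rw [eLpNorm_const' _ hp0 hp]
        have : Tendsto (fun ε : ℝ => ‖ε‖ₑ) (𝓝[>] 0) (𝓝 0) :=
          (continuous_enorm.tendsto' (0 : ℝ) 0 enorm_zero).mono_left nhdsWithin_le_nhds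
        simpa using ENNReal.Tendsto.mul_const this
          (.inr (ENNReal.rpow_ne_top_of_nonneg (by positivity) (measure_ne_top μ Set.univ)))
      obtain ⟨ε, hεδ, hε⟩ :=
        ((ENNReal.tendsto_nhds_zero.mp hlim _ hδ2).and self_mem_nhdsWithin).exists
      exact ⟨ε, hε, hεδ⟩
    obtain ⟨η, hη, hyη⟩ := (Lp.memLp y).eLpNorm_indicator_le hp1 hp hr
    filter_upwards [ENNReal.tendsto_nhds_zero.mp (h ε hε) (ENNReal.ofReal η) (by simpa using hη)]
      with i hi
    have hs : MeasurableSet {t | ε < |x i t|} :=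
      measurableSet_lt measurable_const (Lp.stronglyMeasurable (x i)).measurable.abs
    calc _ ≤ _ := eLpNorm_abs_inf_le hp1 hy hε.le ((hyη _ hs hi).trans hrδ)
      _ ≤ δ / 2 + δ / 2 := by gcongr
      _ = δ := ENNReal.add_halves δ
end

section
/- In the Banach lattice ℓ₁ of absolutely summable real sequences, the sequence of unit vectors (e_k) d-converges to 0 (so the set {e_k : k ∈ ℕ} ∪ {0} is d-compact), but {e_k : k ∈ ℕ} is not PL-compact: for the positive functional f ∈ (ℓ₁)′ given by f(x) = Σ_{i=1}^∞ x_i one has f(|x|) = ‖x‖₁ for all x, and (e_k) has no subsequence that is Cauchy with respect to the seminorm x ↦ f(|x|), i.e. no norm-convergent subsequence. -/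
open Filter Topology

theorem lp.tsum_abs_eq_norm {α : Type*} (x : lp (fun _ : α => ℝ) 1) : ∑' i, |x i| = ‖x‖ := by
  simp [lp.norm_eq_tsum_rpow (p := 1) (by simp) x]

theorem lp.tsum_min_abs_single {α : Type*} [DecidableEq α] (y : α → ℝ) (hy : ∀ i, 0 ≤ y i)
    (k : α) :
    ∑' i, min |(lp.single 1 k (1 : ℝ) : lp (fun _ : α => ℝ) 1) i| (y i) = min 1 (y k) := by
  rw [tsum_eq_single k]
  · simp
  · intro i hi
    simp [hi, hy i]

theorem lp.one_le_dist_single {α : Type*} [DecidableEq α] {k l : α} (h : k ≠ l) :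
    1 ≤ dist (lp.single 1 k (1 : ℝ) : lp (fun _ : α => ℝ) 1) (lp.single 1 l (1 : ℝ)) := by
  rw [dist_eq_norm]
  refine le_trans ?_ (lp.norm_apply_le_norm one_ne_zero _ k)
  simp [h]

/-- In the Banach lattice `ℓ₁` of absolutely summable real sequences, the standard unit
vectors `e_k = lp.single 1 k 1` d-converge to `0`
(`‖|e_k| ⊓ y‖₁ = ∑ᵢ min |e_k i| (y i) → 0` for every `0 ≤ y ∈ ℓ₁`), but `{e_k}` is not
PL-compact: for the positive functional `f(x) = Σᵢ xᵢ` one has `f(|x|) = ‖x‖₁` for all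
`x ∈ ℓ₁`, and no subsequence of `(e_k)` is Cauchy with respect to the seminorm
`x ↦ f(|x|)`, i.e. no subsequence is norm-Cauchy (so none is norm-convergent). -/
theorem stmt19 :
    (∀ y : lp (fun _ : ℕ => ℝ) 1, (∀ i : ℕ, 0 ≤ y i) →
      Tendsto (fun k : ℕ => ∑' i : ℕ, min |lp.single 1 k (1 : ℝ) i| (y i)) atTop (𝓝 0)) ∧
    (∀ x : lp (fun _ : ℕ => ℝ) 1, ∑' i : ℕ, |x i| = ‖x‖) ∧
    (∀ φ : ℕ → ℕ, StrictMono φ →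
      ¬ CauchySeq (fun j : ℕ => (lp.single 1 (φ j) (1 : ℝ) : lp (fun _ : ℕ => ℝ) 1))) := by
  refine ⟨fun y hy => ?_, lp.tsum_abs_eq_norm, fun φ hφ hc => ?_⟩
  · have hs : Summable y := by
      have h := (lp.memℓp y).summable (by simp)
      exact Summable.of_norm (by simpa using h)
    refine squeeze_zero (fun k => ?_) (fun k => ?_) hs.tendsto_atTop_zero
    · exact tsum_nonneg fun i => le_min (abs_nonneg _) (hy i)
    · exact (lp.tsum_min_abs_single y hy k).trans_le (min_le_right _ _)
  · obtain ⟨N, hN⟩ := Metric.cauchySeq_iff.mp hc 1 one_pos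
    exact (hN N le_rfl (N + 1) N.le_succ).not_ge
      (lp.one_le_dist_single (hφ N.lt_succ_self).ne)
end
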